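/- Let f : ℝ^n → ℝ be L-smooth convex, and let (x^(k)) be the accelerated gradient method iterates with parameter sequence (A_k) and initial point x₀. For k ≥ 1 define p^(k) := −P_k·(x^(k+1) − x^(k)), where P_k := 4A_k A_{k+1} / ((A_{k+1} − A_k)·Σ_{i=1}^{k} A_i(A_{i+1} − A_i)). Then: (a) p^(k) ∈ dom f* for every k ≥ 1; (b) if p⋆ ∈ dom f*, then for every k ≥ 1, ‖p^(k) − p⋆‖² ≤ B_k·D_f(x₀, p⋆), where B_k := 8·((A_k·√A_{k+1} + Σ_{i=1}^{k} √A_i·(A_i − A_{i−1})) / (Σ_{i=1}^{k} A_i(A_{i+1} − A_i)))². -/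

import Mathlib

open scoped InnerProductSpace
open Filter Topology

/-- Legendre–Fenchel conjugate of `f`, valued in `ℝ ∪ {∞}` (modeled in `EReal`). -/
noncomputable def fconj {n : ℕ} (f : EuclideanSpace ℝ (Fin n) → ℝ)
    (p : EuclideanSpace ℝ (Fin n)) : EReal :=
  ⨆ x : EuclideanSpace ℝ (Fin n), ((⟪p, x⟫_ℝ - f x : ℝ) : EReal)

/-- Effective domain `dom f*` of the Legendre–Fenchel conjugate. -/
noncomputable def fconjDom {n : ℕ} (f : EuclideanSpace ℝ (Fin n) → ℝ) :
    Set (EuclideanSpace ℝ (Fin n)) := {p | fconj f p < ⊤}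

/-- Dual divergence `D_f(x, p) = f x + f*(p) − ⟨p, x⟩` (meaningful for `p ∈ dom f*`). -/
noncomputable def dualDiv {n : ℕ} (f : EuclideanSpace ℝ (Fin n) → ℝ)
    (x p : EuclideanSpace ℝ (Fin n)) : ℝ :=
  f x + (fconj f p).toReal - ⟪p, x⟫_ℝ

/-- `f` is `L`-smooth convex: convex, differentiable, with `L`-Lipschitz gradient. -/
def LSmoothConvex {n : ℕ} (L : ℝ) (f : EuclideanSpace ℝ (Fin n) → ℝ) : Prop :=
  ConvexOn ℝ Set.univ f ∧ Differentiable ℝ f ∧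
    LipschitzWith (Real.toNNReal L) (fun x => gradient f x)

section FirstOrder

variable {E : Type*} [NormedAddCommGroup E] [InnerProductSpace ℝ E] [CompleteSpace E]

/-- The derivative of a differentiable function along a line, in terms of its gradient. -/
theorem hasDerivAt_comp_lineMap_gradient {f : E → ℝ} (hf : Differentiable ℝ f) (y x : E) (t : ℝ) :
    HasDerivAt (fun s : ℝ => f (AffineMap.lineMap y x s))
      ⟪gradient f (AffineMap.lineMap y x t), x - y⟫_ℝ t := by
  have h := (hf (AffineMap.lineMap y x t)).hasGradientAt.hasFDerivAt.comp_hasDerivAt t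
    (AffineMap.hasDerivAt_lineMap (a := y) (b := x) (x := t))
  rwa [InnerProductSpace.toDual_apply_apply] at h

/-- A differentiable convex function lies above its tangent hyperplanes. -/
theorem ConvexOn.add_inner_gradient_le {f : E → ℝ} (hc : ConvexOn ℝ Set.univ f)
    (hf : Differentiable ℝ f) (y x : E) : f y + ⟪gradient f y, x - y⟫_ℝ ≤ f x := by
  have hφ : ConvexOn ℝ Set.univ (fun s : ℝ => f (AffineMap.lineMap y x s)) :=
    hc.comp_affineMap (AffineMap.lineMap y x)
  have h := hφ.le_slope_of_hasDerivAt (Set.mem_univ 0) (Set.mem_univ 1) one_pos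
    (hasDerivAt_comp_lineMap_gradient hf y x 0)
  simp only [slope_def_field, AffineMap.lineMap_apply_zero, AffineMap.lineMap_apply_one] at h
  linarith

/-- The descent lemma: a function with `L`-Lipschitz gradient lies below its quadratic models. -/
theorem le_add_inner_gradient_add_sq_of_lipschitz {f : E → ℝ} {L : ℝ} (hL : 0 ≤ L)
    (hf : Differentiable ℝ f) (hlip : LipschitzWith (Real.toNNReal L) (fun x => gradient f x))
    (y x : E) : f x ≤ f y + ⟪gradient f y, x - y⟫_ℝ + L / 2 * ‖x - y‖ ^ 2 := by
  have hd : ∀ t : ℝ, HasDerivAt (fun s : ℝ => f (AffineMap.lineMap y x s)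
      - s * ⟪gradient f y, x - y⟫_ℝ - s ^ 2 * (L / 2 * ‖x - y‖ ^ 2))
      (⟪gradient f (AffineMap.lineMap y x t), x - y⟫_ℝ - ⟪gradient f y, x - y⟫_ℝ
        - 2 * t * (L / 2 * ‖x - y‖ ^ 2)) t := fun t => by
    have h := ((hasDerivAt_comp_lineMap_gradient hf y x t).sub
      ((hasDerivAt_id t).mul_const ⟪gradient f y, x - y⟫_ℝ)).sub
      ((hasDerivAt_pow 2 t).mul_const (L / 2 * ‖x - y‖ ^ 2))
    exact h.congr_deriv (by simp)
  have hanti := antitoneOn_of_deriv_nonpos (convex_Icc (0 : ℝ) 1)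
    (fun t _ => (hd t).continuousAt.continuousWithinAt)
    (fun t _ => (hd t).differentiableAt.differentiableWithinAt)
    (fun t ht => by
      rw [interior_Icc] at ht
      rw [(hd t).deriv, ← inner_sub_left]
      have h1 := real_inner_le_norm
        (gradient f (AffineMap.lineMap y x t) - gradient f y) (x - y)
      have h2 := hlip.norm_sub_le (AffineMap.lineMap y x t) y
      have h3 : ‖(AffineMap.lineMap y x t : E) - y‖ = t * ‖x - y‖ := by
        rw [AffineMap.lineMap_apply, vsub_eq_sub, vadd_eq_add, add_sub_cancel_right, norm_smul,
          Real.norm_of_nonneg ht.1.le]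
      rw [h3, Real.coe_toNNReal L hL] at h2
      have h4 := mul_le_mul_of_nonneg_right h2 (norm_nonneg (x - y))
      nlinarith)
  have h := hanti (Set.left_mem_Icc.2 zero_le_one) (Set.right_mem_Icc.2 zero_le_one) zero_le_one
  simp only [AffineMap.lineMap_apply_zero, AffineMap.lineMap_apply_one] at h
  linarith

end FirstOrder

section MinNorm

variable {E : Type*} [NormedAddCommGroup E] [InnerProductSpace ℝ E]

/-- The variational inequality satisfied by a minimum-norm point of a convex set. -/
theorem Convex.inner_sub_nonneg_of_forall_norm_le {s : Set E} (hs : Convex ℝ s) {p q : E}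
    (hp : p ∈ s) (hq : q ∈ s) (hmin : ∀ r ∈ s, ‖p‖ ≤ ‖r‖) : 0 ≤ ⟪q - p, p⟫_ℝ := by
  have h1 := (norm_eq_iInf_iff_real_inner_le_zero hs (u := (0 : E)) hp).1 (by
    have : Nonempty s := ⟨⟨p, hp⟩⟩
    refine le_antisymm (le_ciInf fun r => ?_) (ciInf_le ⟨0, ?_⟩ (⟨p, hp⟩ : s))
    · simpa using hmin r r.2
    · rintro _ ⟨r, rfl⟩
      exact norm_nonneg _) q hq
  rw [zero_sub, inner_neg_left] at h1
  rw [real_inner_comm]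
  linarith

end MinNorm

section AcceleratedStep

variable {E : Type*} [NormedAddCommGroup E] [InnerProductSpace ℝ E] [CompleteSpace E]

/-- One step of the potential decrease for the accelerated gradient method, after tilting `f` by
the linear functional `p` and shifting the primal and mirror sequences accordingly. -/
theorem exists_tilted_potential_step {f : E → ℝ} {L : ℝ} (hL : 0 ≤ L)
    (hc : ConvexOn ℝ Set.univ f) (hf : Differentiable ℝ f)
    (hlip : LipschitzWith (Real.toNNReal L) (fun x => gradient f x))
    {A A' r c : ℝ} (hA : 0 ≤ A) (hAA' : A < A') (hstep : L * (A' - A) ^ 2 ≤ 4 * A') (hr : 0 ≤ r)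
    {p x₀ x y z x' z' u : E}
    (hy : y = x + ((A' - A) / A') • (z - x))
    (hz' : z' = z - ((A' - A) / 4) • gradient f y)
    (hx' : x' = (A / A') • x + ((A' - A) / A') • z')
    (hp : 0 ≤ ⟪gradient f y - p, p⟫_ℝ)
    (hu : A • u = A • x + r • p)
    (hpot : A * (f u + c - ⟪p, u⟫_ℝ) + 2 * ‖z + (A / 4) • p - x₀‖ ^ 2
      ≤ A * (f x₀ + c - ⟪p, x₀⟫_ℝ)) :
    ∃ r' : ℝ, 0 ≤ r' ∧ ∃ u' : E, A' • u' = A' • x' + r' • p ∧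
      A' * (f u' + c - ⟪p, u'⟫_ℝ) + 2 * ‖z' + (A' / 4) • p - x₀‖ ^ 2
        ≤ A' * (f x₀ + c - ⟪p, x₀⟫_ℝ) := by
  have hA' : 0 < A' := hA.trans_lt hAA'
  obtain ⟨a, ha, rfl⟩ : ∃ a, 0 < a ∧ A' = A + a := ⟨A' - A, by linarith, by ring⟩
  have haa : A + a - A = a := by ring
  rw [haa] at hstep hy hz' hx'
  have hyA : (A + a) • y = A • x + a • z := by
    rw [hy, smul_add, smul_smul, mul_div_cancel₀ _ hA'.ne']
    module
  set q := gradient f y - p with hq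
  have hg : gradient f y = q + p := by rw [hq]; abel
  rw [hg] at hz'
  have hxA : (A + a) • x' = A • x + a • z' := by
    rw [hx', smul_add, smul_smul, smul_smul, mul_div_cancel₀ _ hA'.ne',
      mul_div_cancel₀ _ hA'.ne']
  refine ⟨a ^ 2 / 4, by positivity, y - (a ^ 2 / (4 * (A + a))) • q, ?_, ?_⟩
  · have h : (A + a) * (a ^ 2 / (4 * (A + a))) = a ^ 2 / 4 := by field_simp
    rw [smul_sub, smul_smul, h, hyA, hxA, hz']
    module
  · have hdesc := le_add_inner_gradient_add_sq_of_lipschitz hL hf hlip y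
      (y - (a ^ 2 / (4 * (A + a))) • q)
    have hu1 := mul_le_mul_of_nonneg_left (hc.add_inner_gradient_le hf y u) hA
    have hx01 := mul_le_mul_of_nonneg_left (hc.add_inner_gradient_le hf y x₀) ha.le
    rw [hg] at hdesc hu1 hx01
    rw [sub_sub_cancel_left, inner_neg_right, norm_neg, norm_smul, inner_smul_right,
      Real.norm_of_nonneg (by positivity : 0 ≤ a ^ 2 / (4 * (A + a)))] at hdesc
    have hcoef : (A + a) * (L / 2 * (a ^ 2 / (4 * (A + a)) * ‖q‖) ^ 2) ≤ a ^ 2 / 8 * ‖q‖ ^ 2 := by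
      have : (A + a) * (L / 2 * (a ^ 2 / (4 * (A + a)) * ‖q‖) ^ 2)
          = (L * a ^ 2) / (4 * (A + a)) * (a ^ 2 / 8 * ‖q‖ ^ 2) := by
        field_simp
        ring
      rw [this]
      exact mul_le_of_le_one_left (by positivity) ((div_le_one (by positivity)).2 hstep)
    have hcoef' : (A + a) * (a ^ 2 / (4 * (A + a))) = a ^ 2 / 4 := by field_simp
    have hdesc' := mul_le_mul_of_nonneg_left hdesc hA'.le
    have hw : ‖z' + ((A + a) / 4) • p - x₀‖ ^ 2
        = ‖z + (A / 4) • p - x₀‖ ^ 2 - a / 2 * ⟪q, z + (A / 4) • p - x₀⟫_ℝ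
          + a ^ 2 / 16 * ‖q‖ ^ 2 := by
      have : z' + ((A + a) / 4) • p - x₀ = (z + (A / 4) • p - x₀) - (a / 4) • q := by
        rw [hz']
        module
      rw [this, norm_sub_sq_real, inner_smul_right, norm_smul, mul_pow, Real.norm_eq_abs, sq_abs,
        real_inner_comm]
      ring
    have hlin : A * ⟪q, u - y⟫_ℝ + a * ⟪q, x₀ - y⟫_ℝ = r * ⟪q, p⟫_ℝ + a * ⟪q, x₀ - z⟫_ℝ := by
      simp only [← inner_smul_right, ← inner_add_right]
      congr 1
      have : A • (u - y) + a • (x₀ - y) = A • u + a • x₀ - (A + a) • y := by module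
      rw [this, hyA, hu]
      module
    have hrp : 0 ≤ r * ⟪q, p⟫_ℝ := mul_nonneg hr hp
    have hAp : 0 ≤ a * A / 4 * ⟪q, p⟫_ℝ := mul_nonneg (by positivity) hp
    rw [hw]
    simp only [inner_add_left, inner_add_right, inner_sub_right, inner_smul_right,
      real_inner_self_eq_norm_sq] at *
    have hmul : (A + a) * (a ^ 2 / (4 * (A + a)) * (⟪q, q⟫_ℝ + ⟪p, q⟫_ℝ))
        = a ^ 2 / 4 * (⟪q, q⟫_ℝ + ⟪p, q⟫_ℝ) := by rw [← mul_assoc, hcoef']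
    have hmul' : (A + a) * (a ^ 2 / (4 * (A + a)) * ⟪p, q⟫_ℝ)
        = a ^ 2 / 4 * ⟪p, q⟫_ℝ := by rw [← mul_assoc, hcoef']
    rw [real_inner_self_eq_norm_sq] at hmul
    linarith

end AcceleratedStep

section Conjugate

variable {n : ℕ} {f : EuclideanSpace ℝ (Fin n) → ℝ}

theorem mem_fconjDom_of_forall_le {p : EuclideanSpace ℝ (Fin n)} {M : ℝ}
    (h : ∀ x, ⟪p, x⟫_ℝ - f x ≤ M) : p ∈ fconjDom f :=
  (iSup_le fun x => EReal.coe_le_coe_iff.2 (h x)).trans_lt (EReal.coe_lt_top M)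

theorem inner_sub_le_toReal_fconj {p : EuclideanSpace ℝ (Fin n)} (hp : p ∈ fconjDom f)
    (x : EuclideanSpace ℝ (Fin n)) : ⟪p, x⟫_ℝ - f x ≤ (fconj f p).toReal := by
  have h : ((⟪p, x⟫_ℝ - f x : ℝ) : EReal) ≤ fconj f p :=
    le_iSup (fun x => ((⟪p, x⟫_ℝ - f x : ℝ) : EReal)) x
  have hbot : fconj f p ≠ ⊥ := fun hb =>
    EReal.coe_ne_bot _ (le_bot_iff.1 (hb ▸ h))
  rwa [← EReal.coe_toReal hp.ne hbot, EReal.coe_le_coe_iff] at h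

theorem dualDiv_nonneg {p : EuclideanSpace ℝ (Fin n)} (hp : p ∈ fconjDom f)
    (x : EuclideanSpace ℝ (Fin n)) : 0 ≤ dualDiv f x p := by
  have := inner_sub_le_toReal_fconj hp x
  unfold dualDiv
  linarith

theorem convex_fconjDom : Convex ℝ (fconjDom f) := by
  intro p hp q hq a b ha hb hab
  refine mem_fconjDom_of_forall_le
    (M := a * (fconj f p).toReal + b * (fconj f q).toReal) fun x => ?_
  have h1 := mul_le_mul_of_nonneg_left (inner_sub_le_toReal_fconj hp x) ha
  have h2 := mul_le_mul_of_nonneg_left (inner_sub_le_toReal_fconj hq x) hb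
  have h3 : f x = a * f x + b * f x := by rw [← add_mul, hab, one_mul]
  rw [inner_add_left, real_inner_smul_left, real_inner_smul_left]
  linarith

theorem gradient_mem_fconjDom (hc : ConvexOn ℝ Set.univ f) (hf : Differentiable ℝ f)
    (y : EuclideanSpace ℝ (Fin n)) : gradient f y ∈ fconjDom f := by
  refine mem_fconjDom_of_forall_le (M := ⟪gradient f y, y⟫_ℝ - f y) fun x => ?_
  have h := hc.add_inner_gradient_le hf y x
  rw [inner_sub_right] at h
  linarith

end Conjugate

section Sums

variable {E : Type*} [AddCommGroup E] [Module ℝ E]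

/-- Along the accelerated gradient method, the gap between the primal and mirror sequences is a
weighted sum of the gradients. -/
theorem smul_sub_eq_sum_smul_of_recursion {A : ℕ → ℝ} (hA0 : A 0 = 0) {x z g : ℕ → E}
    (hz : ∀ k, z (k + 1) = z k - ((A (k + 1) - A k) / 4) • g k)
    (hx : ∀ k, A (k + 1) • x (k + 1) = A k • x k + (A (k + 1) - A k) • z (k + 1)) (k : ℕ) :
    (4 * A (k + 1)) • (x (k + 1) - z (k + 1))
      = ∑ i ∈ Finset.Icc 1 k, (A i * (A (i + 1) - A i)) • g i := by
  induction k with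
  | zero =>
    have h := hx 0
    rw [hA0] at h
    simp only [zero_add, zero_smul, sub_zero] at h
    simp [mul_smul, smul_sub, h]
  | succ k ih =>
    rw [Finset.sum_Icc_succ_top (by omega), ← ih, mul_smul, smul_sub (A (k + 1 + 1)), hx (k + 1),
      hz (k + 1)]
    module

/-- Summation by parts for sequences with increments `(A (k + 1) - A k) • d k`. -/
theorem sum_smul_eq_smul_sub_sum_of_increment {A : ℕ → ℝ} (hA0 : A 0 = 0) {Z d : ℕ → E}
    (hZ : ∀ k, Z (k + 1) = Z k + (A (k + 1) - A k) • d k) (k : ℕ) :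
    ∑ i ∈ Finset.Icc 1 k, (A i * (A (i + 1) - A i)) • d i
      = A k • Z (k + 1) - ∑ i ∈ Finset.Icc 1 k, (A i - A (i - 1)) • Z i := by
  induction k with
  | zero => simp [hA0]
  | succ k ih =>
    rw [Finset.sum_Icc_succ_top (by omega), Finset.sum_Icc_succ_top (by omega), ih,
      hZ (k + 1), Nat.add_sub_cancel]
    module

end Sums

/-- for the accelerated gradient method, with
`P_k = 4 A_k A_{k+1} / ((A_{k+1} − A_k) Σ_{i=1}^k A_i (A_{i+1} − A_i))` and
`p^(k) = −P_k (x^(k+1) − x^(k))`: (a) `p^(k) ∈ dom f*`; (b) if `p⋆ ∈ dom f*`,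
`‖p^(k) − p⋆‖² ≤ B_k D_f(x₀, p⋆)`, with
`B_k = 8 ((A_k √A_{k+1} + Σ_{i=1}^k √A_i (A_i − A_{i−1})) / (Σ_{i=1}^k A_i (A_{i+1} − A_i)))²`. -/
theorem stmt18 {n : ℕ} (hn : 1 ≤ n) (L : ℝ) (hL : 0 < L)
    (f : EuclideanSpace ℝ (Fin n) → ℝ) (hf : LSmoothConvex L f)
    (A : ℕ → ℝ) (hA0 : A 0 = 0) (hAmono : ∀ k, A k < A (k + 1))
    (hAstep : ∀ k, L * (A (k + 1) - A k) ^ 2 ≤ 4 * A (k + 1))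
    (x₀ : EuclideanSpace ℝ (Fin n))
    (x y z : ℕ → EuclideanSpace ℝ (Fin n))
    (hx0 : x 0 = x₀) (hz0 : z 0 = x₀)
    (hy : ∀ k, y k = x k + ((A (k + 1) - A k) / A (k + 1)) • (z k - x k))
    (hzs : ∀ k, z (k + 1) = z k - ((A (k + 1) - A k) / 4) • gradient f (y k))
    (hxs : ∀ k, x (k + 1) =
      (A k / A (k + 1)) • x k + ((A (k + 1) - A k) / A (k + 1)) • z (k + 1))
    (pstar : EuclideanSpace ℝ (Fin n))
    (hps : pstar ∈ closure (fconjDom f))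
    (hmin : ∀ q ∈ closure (fconjDom f), ‖pstar‖ ≤ ‖q‖) :
    (∀ k : ℕ, 1 ≤ k →
      -((4 * A k * A (k + 1) /
          ((A (k + 1) - A k) * ∑ i ∈ Finset.Icc 1 k, A i * (A (i + 1) - A i))) •
        (x (k + 1) - x k)) ∈ fconjDom f) ∧
    (pstar ∈ fconjDom f → ∀ k : ℕ, 1 ≤ k →
      ‖-((4 * A k * A (k + 1) /
            ((A (k + 1) - A k) * ∑ i ∈ Finset.Icc 1 k, A i * (A (i + 1) - A i))) •
          (x (k + 1) - x k)) - pstar‖ ^ 2 ≤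
        (8 * ((A k * Real.sqrt (A (k + 1)) +
            ∑ i ∈ Finset.Icc 1 k, Real.sqrt (A i) * (A i - A (i - 1))) /
          (∑ i ∈ Finset.Icc 1 k, A i * (A (i + 1) - A i))) ^ 2) *
          dualDiv f x₀ pstar) := by
  obtain ⟨hc, hd, hlip⟩ := hf
  have hApos : ∀ k, 1 ≤ k → 0 < A k := fun k hk => by
    rw [← hA0]
    exact strictMono_nat_of_lt_succ hAmono hk
  have hAnn : ∀ k, 0 ≤ A k := fun k => by
    rcases Nat.eq_zero_or_pos k with rfl | hk
    · exact hA0.ge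
    · exact (hApos k hk).le
  have hxA : ∀ k, A (k + 1) • x (k + 1) = A k • x k + (A (k + 1) - A k) • z (k + 1) := fun k => by
    rw [hxs, smul_add, smul_smul, smul_smul, mul_div_cancel₀ _ (hApos (k + 1) (by omega)).ne',
      mul_div_cancel₀ _ (hApos (k + 1) (by omega)).ne']
  have hwpos : ∀ i, 1 ≤ i → 0 < A i * (A (i + 1) - A i) := fun i hi =>
    mul_pos (hApos i hi) (sub_pos.2 (hAmono i))
  have hSpos : ∀ k, 1 ≤ k → 0 < ∑ i ∈ Finset.Icc 1 k, A i * (A (i + 1) - A i) := fun k hk =>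
    Finset.sum_pos (fun i hi => hwpos i (Finset.mem_Icc.1 hi).1) ⟨1, by simpa using hk⟩
  have hgap := smul_sub_eq_sum_smul_of_recursion hA0 hzs hxA
  have hpk : ∀ k, 1 ≤ k → -((4 * A k * A (k + 1) /
      ((A (k + 1) - A k) * ∑ i ∈ Finset.Icc 1 k, A i * (A (i + 1) - A i))) • (x (k + 1) - x k))
      = (∑ i ∈ Finset.Icc 1 k, A i * (A (i + 1) - A i))⁻¹ •
        ∑ i ∈ Finset.Icc 1 k, (A i * (A (i + 1) - A i)) • gradient f (y i) := fun k hk => by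
    rw [← hgap k]
    have hS := hSpos k hk
    have ha : 0 < A (k + 1) - A k := sub_pos.2 (hAmono k)
    set S := ∑ i ∈ Finset.Icc 1 k, A i * (A (i + 1) - A i)
    have h1 : A k • (x (k + 1) - x k) = (A (k + 1) - A k) • (z (k + 1) - x (k + 1)) := by
      have h : A k • (x (k + 1) - x k) = A (k + 1) • x (k + 1) - A k • x k
        - (A (k + 1) - A k) • x (k + 1) := by module
      rw [h, hxA k]
      module
    have h2 : 4 * A k * A (k + 1) / ((A (k + 1) - A k) * S)
        = (4 * A (k + 1) / ((A (k + 1) - A k) * S)) * A k := by ring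
    have h3 : 4 * A (k + 1) / ((A (k + 1) - A k) * S) * (A (k + 1) - A k)
        = S⁻¹ * (4 * A (k + 1)) := by field_simp
    rw [h2, mul_smul, h1, smul_smul, h3, mul_smul, ← smul_neg, ← smul_neg, neg_sub]
  refine ⟨fun k hk => ?_, fun hp k hk => ?_⟩
  · rw [hpk k hk]
    exact convex_fconjDom.centerMass_mem
      (fun i hi => (hwpos i (Finset.mem_Icc.1 hi).1).le) (hSpos k hk)
      (fun i _ => gradient_mem_fconjDom hc hd (y i))
  · have hpot : ∀ k, ∃ r : ℝ, 0 ≤ r ∧ ∃ u : EuclideanSpace ℝ (Fin n),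
        A k • u = A k • x k + r • pstar ∧
        A k * (f u + (fconj f pstar).toReal - ⟪pstar, u⟫_ℝ)
          + 2 * ‖z k + (A k / 4) • pstar - x₀‖ ^ 2
          ≤ A k * (f x₀ + (fconj f pstar).toReal - ⟪pstar, x₀⟫_ℝ) := fun k => by
      induction k with
      | zero => exact ⟨0, le_rfl, x 0, by simp, by simp [hA0, hz0]⟩
      | succ k ih =>
        obtain ⟨r, hr, u, hu, hpot⟩ := ih
        exact exists_tilted_potential_step hL.le hc hd hlip (hAnn k) (hAmono k) (hAstep k) hr
          (hy k) (hzs k) (hxs k)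
          (convex_fconjDom.inner_sub_nonneg_of_forall_norm_le hp
            (gradient_mem_fconjDom hc hd (y k)) fun q hq => hmin q (subset_closure hq))
          hu hpot
    have hD := dualDiv_nonneg hp x₀
    set D := dualDiv f x₀ pstar with hDdef
    obtain ⟨Z, hZdef⟩ : ∃ Z : ℕ → EuclideanSpace ℝ (Fin n),
        ∀ k, Z k = (4 : ℝ) • (x₀ - z k) - A k • pstar := ⟨_, fun _ => rfl⟩
    have hZstep : ∀ k, Z (k + 1) = Z k + (A (k + 1) - A k) • (gradient f (y k) - pstar) :=
      fun k => by
        rw [hZdef, hZdef, hzs]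
        module
    have hZnorm : ∀ k, ‖Z k‖ ≤ √(8 * D) * √(A k) := fun k => by
      obtain ⟨r, hr, u, hu, h⟩ := hpot k
      have h1 := mul_nonneg (hAnn k) (dualDiv_nonneg hp u)
      have h2 : Z k = (-4 : ℝ) • (z k + (A k / 4) • pstar - x₀) := by
        rw [hZdef]
        module
      rw [← Real.sqrt_mul (by positivity)]
      apply Real.le_sqrt_of_sq_le
      rw [h2, norm_smul, mul_pow]
      simp only [dualDiv] at h1 hDdef
      rw [← hDdef] at h
      norm_num
      linarith
    have hS := hSpos k hk
    have hsum := sum_smul_eq_smul_sub_sum_of_increment hA0 hZstep k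
    rw [hpk k hk]
    set S := ∑ i ∈ Finset.Icc 1 k, A i * (A (i + 1) - A i) with hSdef
    set T := A k * √(A (k + 1)) + ∑ i ∈ Finset.Icc 1 k, √(A i) * (A i - A (i - 1)) with hT
    have hdiff : S⁻¹ • ∑ i ∈ Finset.Icc 1 k, (A i * (A (i + 1) - A i)) • gradient f (y i) - pstar
        = S⁻¹ • ∑ i ∈ Finset.Icc 1 k, (A i * (A (i + 1) - A i)) • (gradient f (y i) - pstar) := by
      simp only [smul_sub, Finset.sum_sub_distrib, ← Finset.sum_smul]
      rw [← hSdef, inv_smul_smul₀ hS.ne']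
    have hnorm : ‖A k • Z (k + 1) - ∑ i ∈ Finset.Icc 1 k, (A i - A (i - 1)) • Z i‖
        ≤ √(8 * D) * T := by
      refine (norm_sub_le _ _).trans ?_
      rw [hT, mul_add]
      refine add_le_add ?_ ?_
      · rw [norm_smul, Real.norm_of_nonneg (hAnn k)]
        have := mul_le_mul_of_nonneg_left (hZnorm (k + 1)) (hAnn k)
        linarith
      · rw [Finset.mul_sum]
        refine norm_sum_le_of_le _ fun i hi => ?_
        have hi1 : i - 1 + 1 = i := Nat.sub_add_cancel (Finset.mem_Icc.1 hi).1
        have hmon : 0 ≤ A i - A (i - 1) := by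
          have := hAmono (i - 1)
          rw [hi1] at this
          linarith
        rw [norm_smul, Real.norm_of_nonneg hmon]
        have := mul_le_mul_of_nonneg_left (hZnorm i) hmon
        linarith
    rw [hdiff, hsum, norm_smul, mul_pow, Real.norm_of_nonneg (inv_nonneg.2 hS.le)]
    have hsq := pow_le_pow_left₀ (norm_nonneg _) hnorm 2
    rw [mul_pow, Real.sq_sqrt (by positivity)] at hsq
    calc S⁻¹ ^ 2 * ‖A k • Z (k + 1) - ∑ i ∈ Finset.Icc 1 k, (A i - A (i - 1)) • Z i‖ ^ 2
        ≤ S⁻¹ ^ 2 * (8 * D * T ^ 2) := mul_le_mul_of_nonneg_left hsq (by positivity)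
      _ = 8 * (T / S) ^ 2 * D := by ring
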